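/- arXiv:2112.10169 — 2 statements merged into one kernel-verified Lean document; each statement's English description precedes it below -/
import Mathlib

section
/- Let n ∈ ℕ, let r₁,…,rₙ > 0, let [a,b] be a non-degenerate compact interval, and let w : [a,b] → [0,∞) be an upper semicontinuous weight that is nonzero on a set of weighted cardinality exceeding n (points of (a,b) counted with weight 1, the endpoints a and b with weight 1/2). Then there exists a unique node system x* = (x₁*,…,xₙ*) with a ≤ x₁* ≤ ⋯ ≤ xₙ* ≤ b minimizing ‖T_x‖_w over all node systems a ≤ x₁ ≤ ⋯ ≤ xₙ ≤ b, and in fact a < x₁* < ⋯ < xₙ* < b. Moreover, a node system x with a ≤ x₁ ≤ ⋯ ≤ xₙ ≤ b equals x* if and only if there exist points t₀,…,tₙ interlacing with the nodes, i.e., a ≤ t₀ < x₁ < t₁ < x₂ < ⋯ < xₙ < tₙ ≤ b, such that w(t_k)·T_x(t_k) = ‖T_x‖_w for k = 0,1,…,n. -/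
open Set Filter

noncomputable section

/-- The monic generalized algebraic polynomial `T_x(t) = ∏ⱼ |t − xⱼ|^{rⱼ}`. -/
def gap {n : ℕ} (r x : Fin n → ℝ) (t : ℝ) : ℝ := ∏ j, |t - x j| ^ r j

/-- The `w`-weighted sup norm of `T_x` over `[a,b]`. -/
def wnorm (w : ℝ → ℝ) (a b : ℝ) {n : ℕ} (r x : Fin n → ℝ) : ℝ :=
  sSup ((fun t => w t * gap r x t) '' Icc a b)

/-- Admissible node systems in `[a,b]`. -/
def adm (a b : ℝ) {n : ℕ} (x : Fin n → ℝ) : Prop :=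
  Monotone x ∧ ∀ j, x j ∈ Icc a b

/-- The weight `w` is nonzero on a set of weighted cardinality exceeding `n`
(interior points of `[a,b]` count `1`, the endpoints `1/2`). -/
def weightCardGT (w : ℝ → ℝ) (a b : ℝ) (n : ℕ) : Prop :=
  ∃ T : Finset ℝ, (T : Set ℝ) ⊆ Icc a b ∧ (∀ t ∈ T, w t ≠ 0) ∧
    (n : ℝ) < ∑ t ∈ T, (if t = a ∨ t = b then (1/2 : ℝ) else 1)

/-- Partial fraction expansion of `∏ⱼ (u - zⱼ) / ∏ₖ (u - tₖ)` with one more pole than zeros. -/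
lemma sum_residue_div {n : ℕ} {t : Fin (n + 1) → ℝ} (ht : StrictMono t) (z : Fin n → ℝ) {u : ℝ}
    (hu : ∀ k, u ≠ t k) :
    ∑ k, (∏ j, (t k - z j) / (t k - t (k.succAbove j))) / (u - t k) =
      (∏ j, (u - z j)) / ∏ k, (u - t k) := by
  have hdeg : (Lagrange.nodal Finset.univ z).degree < (Finset.univ : Finset (Fin (n + 1))).card := by
    rw [Lagrange.degree_nodal, Finset.card_univ, Finset.card_univ, Fintype.card_fin, Fintype.card_fin]
    exact_mod_cast n.lt_succ_self
  have h1 := Lagrange.eq_interpolate (s := Finset.univ) (v := t) (ht.injective.injOn) hdeg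
  have h2 := Lagrange.eval_interpolate_not_at_node (s := Finset.univ) (v := t) (x := u)
    (fun i => (Lagrange.nodal Finset.univ z).eval (t i)) (fun i _ => hu i)
  rw [← h1, Lagrange.eval_nodal, Lagrange.eval_nodal] at h2
  have hne : ∏ k, (u - t k) ≠ 0 := Finset.prod_ne_zero_iff.2 fun k _ => sub_ne_zero.2 (hu k)
  rw [h2, mul_div_cancel_left₀ _ hne]
  refine Finset.sum_congr rfl fun k _ => ?_
  have hw : Lagrange.nodalWeight Finset.univ t k = ∏ j, (t k - t (k.succAbove j))⁻¹ := by
    unfold Lagrange.nodalWeight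
    have : (Finset.univ.erase k : Finset (Fin (n + 1))) =
        Finset.univ.map (Fin.succAboveEmb k) := by
      ext i; simp [Fin.exists_succAbove_eq_iff]
    rw [this, Finset.prod_map]; rfl
  rw [hw, Lagrange.eval_nodal, Finset.prod_div_distrib, Finset.prod_inv_distrib]
  ring

/-- The pairing behind the sign of `∏ⱼ (u - zⱼ) / ∏ₖ (u - tₖ)`. -/
lemma prod_div_prod_eq_succAbove {n : ℕ} (t : Fin (n + 1) → ℝ) (z : Fin n → ℝ) (u : ℝ)
    (m : Fin (n + 1)) :
    (∏ j, (u - z j)) / ∏ k, (u - t k) =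
      (∏ j, (u - z j) / (u - t (m.succAbove j))) / (u - t m) := by
  rw [Fin.prod_univ_succAbove _ m, Finset.prod_div_distrib, div_div, mul_comm]

lemma prod_div_prod_nonneg {n : ℕ} {t : Fin (n + 1) → ℝ} (ht : StrictMono t) {x y z : Fin n → ℝ}
    (hy : Monotone y) (hz : ∀ j, z j = max (t j.castSucc) (min (y j) (t j.succ)))
    {j : Fin n} (hx : t j.castSucc < x j) {u : ℝ} (hxu : x j < u) (huy : u < y j)
    (hu : ∀ k, u ≠ t k) :
    0 ≤ (∏ l, (u - z l)) / ∏ k, (u - t k) := by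
  classical
  obtain ⟨m, hm, hmax⟩ := (Finset.univ.filter fun k => t k < u).exists_max_image id
    ⟨j.castSucc, by simpa using hx.trans hxu⟩
  simp only [Finset.mem_filter, Finset.mem_univ, true_and, id] at hm hmax
  have hjm := hmax _ (hx.trans hxu)
  rw [prod_div_prod_eq_succAbove t z u m]
  refine div_nonneg (Finset.prod_nonneg fun l _ => ?_) (sub_pos.2 hm).le
  have hl := ht l.castSucc_lt_succ
  rcases lt_or_ge l.castSucc m with h | h
  · rw [Fin.succAbove_of_castSucc_lt _ _ h]
    have h1 : t l.succ ≤ t m := ht.monotone (Fin.castSucc_lt_iff_succ_le.1 h)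
    have h2 : z l ≤ t l.succ := by rw [hz]; exact max_le hl.le (min_le_right _ _)
    exact div_nonneg (by linarith) (by linarith)
  · rw [Fin.succAbove_of_le_castSucc _ _ h]
    have h1 : u < t l.succ := by
      refine lt_of_le_of_ne (not_lt.1 fun hc => ?_) (hu _)
      exact absurd (hmax _ hc) (not_le.2 (h.trans_lt l.castSucc_lt_succ))
    have h2 : y j ≤ y l := hy (Fin.castSucc_le_castSucc_iff.1 (hjm.trans h))
    have h3 : u < z l := by
      rw [hz]; exact lt_max_of_lt_right (lt_min (by linarith) h1)
    exact div_nonneg_of_nonpos (by linarith) (by linarith)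

lemma prod_div_prod_nonpos {n : ℕ} {t : Fin (n + 1) → ℝ} (ht : StrictMono t) {x y z : Fin n → ℝ}
    (hy : Monotone y) (hz : ∀ j, z j = max (t j.castSucc) (min (y j) (t j.succ)))
    {j : Fin n} (hx : x j < t j.succ) {u : ℝ} (hux : u < x j) (hyu : y j < u)
    (hu : ∀ k, u ≠ t k) :
    (∏ l, (u - z l)) / ∏ k, (u - t k) ≤ 0 := by
  classical
  obtain ⟨m, hm, hmin⟩ := (Finset.univ.filter fun k => u < t k).exists_min_image id
    ⟨j.succ, by simpa using hux.trans hx⟩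
  simp only [Finset.mem_filter, Finset.mem_univ, true_and, id] at hm hmin
  have hjm := hmin _ (hux.trans hx)
  rw [prod_div_prod_eq_succAbove t z u m]
  refine div_nonpos_of_nonneg_of_nonpos (Finset.prod_nonneg fun l _ => ?_) (sub_neg.2 hm).le
  have hl := ht l.castSucc_lt_succ
  rcases lt_or_ge l.castSucc m with h | h
  · rw [Fin.succAbove_of_castSucc_lt _ _ h]
    have h1 : t l.castSucc < u := by
      refine lt_of_le_of_ne (not_lt.1 fun hc => ?_) (hu _).symm
      exact absurd (hmin _ hc) (not_le.2 h)
    have h2 : y l ≤ y j := hy (Fin.succ_le_succ_iff.1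
      ((Fin.castSucc_lt_iff_succ_le.1 h).trans hjm))
    have h3 : z l < u := by
      rw [hz]; exact max_lt h1 (min_lt_of_left_lt (by linarith))
    exact div_nonneg (by linarith) (by linarith)
  · rw [Fin.succAbove_of_le_castSucc _ _ h]
    have h1 : t m ≤ t l.castSucc := ht.monotone h
    have h2 : t l.castSucc ≤ z l := by rw [hz]; exact le_max_left _ _
    exact div_nonneg_of_nonpos (by linarith) (by linarith)

lemma log_gap {n : ℕ} (r x : Fin n → ℝ) {s : ℝ} (h : ∀ j, s ≠ x j) :
    Real.log (gap r x s) = ∑ j, r j * Real.log |x j - s| := by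
  have hpos : ∀ j, 0 < |s - x j| := fun j => abs_pos.2 (sub_ne_zero.2 (h j))
  unfold gap
  rw [Real.log_prod fun j _ => (Real.rpow_pos_of_pos (hpos j) _).ne']
  refine Finset.sum_congr rfl fun j _ => ?_
  rw [Real.log_rpow (hpos j), abs_sub_comm]

lemma gap_pos {n : ℕ} (r x : Fin n → ℝ) {s : ℝ} (h : ∀ j, s ≠ x j) : 0 < gap r x s :=
  Finset.prod_pos fun j _ => Real.rpow_pos_of_pos (abs_pos.2 (sub_ne_zero.2 (h j))) _

lemma div_lt_log_abs_sub {x y s : ℝ} (hxy : x ≠ y) (h : 0 < (x - s) / (y - s)) :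
    (y - x) / (y - s) < Real.log |y - s| - Real.log |x - s| := by
  have hy : y - s ≠ 0 := fun h0 => by simp [h0] at h
  have hx : x - s ≠ 0 := fun h0 => by simp [h0] at h
  have h1 := Real.log_lt_sub_one_of_pos h (by rw [Ne, div_eq_one_iff_eq hy]; simpa using hxy)
  rw [← Real.log_abs, abs_div, Real.log_div (abs_ne_zero.2 hx) (abs_ne_zero.2 hy)] at h1
  have h2 : (y - x) / (y - s) = 1 - (x - s) / (y - s) := by field_simp; ring
  rw [h2]; linarith

/-- If `t` strictly interlaces with `x` and `T_y ≤ T_x` at all points of `t`, then `y = x`. -/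
theorem eq_of_gap_le_of_interlacing {n : ℕ} {r x y : Fin n → ℝ} (hr : ∀ j, 0 < r j)
    (hy : Monotone y) {t : Fin (n + 1) → ℝ}
    (hxt : ∀ j : Fin n, t j.castSucc < x j ∧ x j < t j.succ)
    (hle : ∀ k, gap r y (t k) ≤ gap r x (t k)) : y = x := by
  have ht : StrictMono t := Fin.strictMono_iff_lt_succ.2 fun j => (hxt j).1.trans (hxt j).2
  obtain ⟨z, hz⟩ : ∃ z : Fin n → ℝ, ∀ j, z j = max (t j.castSucc) (min (y j) (t j.succ)) :=
    ⟨_, fun _ => rfl⟩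
  obtain ⟨c, hc⟩ : ∃ c : Fin (n + 1) → ℝ,
    ∀ k, c k = ∏ j, (t k - z j) / (t k - t (k.succAbove j)) := ⟨_, fun _ => rfl⟩
  have hG : ∀ u, (∀ k, u ≠ t k) → ∑ k, c k / (u - t k) = (∏ j, (u - z j)) / ∏ k, (u - t k) := by
    intro u hu
    simp only [hc]
    exact sum_residue_div ht z hu
  have hc0 : ∀ k, 0 ≤ c k := by
    intro k
    rw [hc]
    refine Finset.prod_nonneg fun l _ => ?_
    have hl := ht l.castSucc_lt_succ
    rcases lt_or_ge l.castSucc k with h | h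
    · rw [Fin.succAbove_of_castSucc_lt _ _ h]
      have h1 : t l.succ ≤ t k := ht.monotone (Fin.castSucc_lt_iff_succ_le.1 h)
      have h2 : z l ≤ t l.succ := by rw [hz]; exact max_le hl.le (min_le_right _ _)
      exact div_nonneg (by linarith) (by linarith)
    · rw [Fin.succAbove_of_le_castSucc _ _ h]
      have h1 : t k ≤ t l.castSucc := ht.monotone h
      have h2 : t l.castSucc ≤ z l := by rw [hz]; exact le_max_left _ _
      exact div_nonneg_of_nonpos (by linarith) (by linarith)
  have hcz : ∀ k j, z j = t k → c k = 0 := by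
    intro k j h
    rw [hc]
    exact Finset.prod_eq_zero (Finset.mem_univ j) (by simp [h])
  have hcpos : ∃ k, c k ≠ 0 := by
    by_contra! h
    have hu : ∀ k, t k < t (Fin.last n) + 1 := fun k =>
      (ht.monotone (Fin.le_last k)).trans_lt (lt_add_one _)
    have h1 := hG (t (Fin.last n) + 1) fun k => (hu k).ne'
    have h2 : 0 < (∏ j, (t (Fin.last n) + 1 - z j)) / ∏ k, (t (Fin.last n) + 1 - t k) := by
      refine div_pos (Finset.prod_pos fun j _ => ?_) (Finset.prod_pos fun k _ => ?_)
      · have : z j ≤ t j.succ := by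
          rw [hz]; exact max_le (ht j.castSucc_lt_succ).le (min_le_right _ _)
        linarith [hu j.succ]
      · linarith [hu k]
    simp [h] at h1
    linarith
  have hsep1 : ∀ j k, c k ≠ 0 → x j ≤ t k → y j < t k := by
    intro j k hk h1
    by_contra! h2
    have hjk : j.castSucc < k := ht.lt_iff_lt.1 ((hxt j).1.trans_le h1)
    obtain ⟨l, rfl⟩ := Fin.exists_succ_eq.2 (Fin.ne_zero_of_lt hjk)
    refine hk (hcz _ l ?_)
    have := hy (Fin.castSucc_lt_succ_iff.1 hjk)
    rw [hz, min_eq_right (by linarith), max_eq_right (ht l.castSucc_lt_succ).le]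
  have hsep2 : ∀ j k, c k ≠ 0 → t k ≤ x j → t k < y j := by
    intro j k hk h1
    by_contra! h2
    have hjk : k < j.succ := ht.lt_iff_lt.1 (h1.trans_lt (hxt j).2)
    obtain ⟨l, rfl⟩ := Fin.exists_castSucc_eq.2 (Fin.ne_last_of_lt hjk)
    refine hk (hcz _ l ?_)
    have := hy (Fin.castSucc_lt_succ_iff.1 hjk)
    rw [hz, min_eq_left (by linarith [ht l.castSucc_lt_succ]), max_eq_left (by linarith)]
  have hxne : ∀ j k, t k ≠ x j := by
    intro j k h
    rcases le_or_gt k j.castSucc with h1 | h1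
    · exact absurd (ht.monotone h1) (not_le.2 (h ▸ (hxt j).1))
    · exact absurd (ht.monotone (Fin.castSucc_lt_iff_succ_le.1 h1)) (not_le.2 (h ▸ (hxt j).2))
  have hratio : ∀ j k, c k ≠ 0 → 0 < (x j - t k) / (y j - t k) := by
    intro j k hk
    rcases lt_or_gt_of_ne (hxne j k) with h | h
    · exact div_pos (sub_pos.2 h) (sub_pos.2 (hsep2 j k hk h.le))
    · exact div_pos_of_neg_of_neg (sub_neg.2 h) (sub_neg.2 (hsep1 j k hk h.le))
  have hyne : ∀ j k, c k ≠ 0 → t k ≠ y j := by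
    intro j k hk h
    simpa [h] using hratio j k hk
  have hcont : ∀ j, ContinuousAt (fun u => ∑ k, c k / (u - t k)) (y j) := by
    intro j
    refine tendsto_finsetSum _ fun k _ => ?_
    by_cases hk : c k = 0
    · simp only [hk, zero_div]; exact tendsto_const_nhds
    · exact (continuousAt_const.div (by fun_prop) (sub_ne_zero.2 (hyne j k hk).symm))
  have hgen : ∀ j, ∀ᶠ u in nhdsWithin (y j) {y j}ᶜ, ∀ k, u ≠ t k := by
    intro j
    refine eventually_all.2 fun k => ?_
    by_cases h : y j = t k
    · rw [← h]; exact self_mem_nhdsWithin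
    · exact nhdsWithin_le_nhds (isOpen_ne.mem_nhds h)
  have hder : ∀ j, 0 ≤ (y j - x j) * ∑ k, c k / (y j - t k) := by
    intro j
    rcases lt_trichotomy (x j) (y j) with h | h | h
    · refine mul_nonneg (sub_nonneg.2 h.le) ?_
      refine ge_of_tendsto ((hcont j).mono_left (nhdsWithin_le_nhds (s := Iio (y j)))) ?_
      filter_upwards [(hgen j).filter_mono (nhdsWithin_mono _ fun u hu => ne_of_lt hu),
        self_mem_nhdsWithin, nhdsWithin_le_nhds (Ioi_mem_nhds h)] with u h1 h2 h3
      rw [hG u h1]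
      exact prod_div_prod_nonneg ht hy hz (hxt j).1 h3 h2 h1
    · simp [h]
    · refine mul_nonneg_of_nonpos_of_nonpos (sub_nonpos.2 h.le) ?_
      refine le_of_tendsto ((hcont j).mono_left (nhdsWithin_le_nhds (s := Ioi (y j)))) ?_
      filter_upwards [(hgen j).filter_mono (nhdsWithin_mono _ fun u hu => ne_of_gt hu),
        self_mem_nhdsWithin, nhdsWithin_le_nhds (Iio_mem_nhds h)] with u h1 h2 h3
      rw [hG u h1]
      exact prod_div_prod_nonpos ht hy hz (hxt j).2 h3 h2 h1
  have hlog : ∀ j, x j ≠ y j →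
      0 < ∑ k, c k * (Real.log |y j - t k| - Real.log |x j - t k|) := by
    intro j hj
    refine (hder j).trans_lt ?_
    rw [Finset.mul_sum]
    have key : ∀ k, c k ≠ 0 → (y j - x j) * (c k / (y j - t k)) <
        c k * (Real.log |y j - t k| - Real.log |x j - t k|) := by
      intro k hk
      rw [mul_div_left_comm]
      exact mul_lt_mul_of_pos_left (div_lt_log_abs_sub hj (hratio j k hk))
        (lt_of_le_of_ne (hc0 k) hk.symm)
    obtain ⟨k0, hk0⟩ := hcpos
    refine Finset.sum_lt_sum (fun k _ => ?_) ⟨k0, Finset.mem_univ _, key k0 hk0⟩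
    by_cases hk : c k = 0
    · simp [hk]
    · exact (key k hk).le
  by_contra hne
  obtain ⟨j0, hj0⟩ := Function.ne_iff.1 hne
  have hpos : 0 < ∑ j, r j * ∑ k, c k * (Real.log |y j - t k| - Real.log |x j - t k|) := by
    refine Finset.sum_pos' (fun j _ => ?_)
      ⟨j0, Finset.mem_univ _, mul_pos (hr j0) (hlog j0 (Ne.symm hj0))⟩
    by_cases h : x j = y j
    · simp [h]
    · exact (mul_pos (hr j) (hlog j h)).le
  have hswap : ∑ j, r j * ∑ k, c k * (Real.log |y j - t k| - Real.log |x j - t k|) =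
      ∑ k, c k * (∑ j, r j * Real.log |y j - t k| - ∑ j, r j * Real.log |x j - t k|) := by
    simp only [Finset.mul_sum, ← Finset.sum_sub_distrib]
    rw [Finset.sum_comm]
    exact Finset.sum_congr rfl fun k _ => Finset.sum_congr rfl fun j _ => by ring
  rw [hswap] at hpos
  refine absurd hpos (not_lt.2 (Finset.sum_nonpos fun k _ => ?_))
  by_cases hk : c k = 0
  · simp [hk]
  · refine mul_nonpos_of_nonneg_of_nonpos (hc0 k) (sub_nonpos.2 ?_)
    rw [← log_gap r y fun j => hyne j k hk, ← log_gap r x fun j => hxne j k]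
    exact Real.log_le_log (gap_pos r y fun j => hyne j k hk) (hle k)

open scoped Topology

lemma gap_nonneg {n : ℕ} (r x : Fin n → ℝ) (s : ℝ) : 0 ≤ gap r x s :=
  Finset.prod_nonneg fun _ _ => Real.rpow_nonneg (abs_nonneg _) _

lemma gap_node {n : ℕ} {r : Fin n → ℝ} (hr : ∀ j, 0 < r j) (x : Fin n → ℝ) (j : Fin n) :
    gap r x (x j) = 0 :=
  Finset.prod_eq_zero (Finset.mem_univ j) (by simp [Real.zero_rpow (hr j).ne'])

lemma continuous_gap {n : ℕ} {r : Fin n → ℝ} (hr : ∀ j, 0 < r j) :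
    Continuous fun p : (Fin n → ℝ) × ℝ => gap r p.1 p.2 := by
  unfold gap
  refine continuous_finsetProd _ fun j _ => Continuous.rpow_const (by fun_prop) fun _ =>
    Or.inr (hr j).le

/-- A nonnegative upper semicontinuous weight on `[a,b]`. -/
structure IsWeight (w : ℝ → ℝ) (a b : ℝ) : Prop where
  nonneg : ∀ t ∈ Icc a b, 0 ≤ w t
  usc : UpperSemicontinuousOn w (Icc a b)

lemma eventually_mul_lt_of_usc {Z : Type*} {l : Filter Z} {S : Set ℝ}
    {w : ℝ → ℝ} {t₀ : ℝ} (hw : UpperSemicontinuousWithinAt w S t₀) {φ g : Z → ℝ} {g₀ c : ℝ}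
    (hφ : Tendsto φ l (𝓝[S] t₀)) (hg : Tendsto g l (𝓝 g₀)) (hg0 : ∀ z, 0 ≤ g z)
    (h : w t₀ * g₀ < c) : ∀ᶠ z in l, w (φ z) * g z < c := by
  have h1 : ∀ᶠ v in 𝓝[>] (w t₀), v * g₀ < c :=
    nhdsWithin_le_nhds ((continuous_id.mul continuous_const).tendsto (w t₀) (Iio_mem_nhds h))
  obtain ⟨v, hv, hv'⟩ := (h1.and self_mem_nhdsWithin).exists
  filter_upwards [hφ.eventually (hw v hv'), (hg.const_mul v).eventually (Iio_mem_nhds hv)]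
    with z hz1 hz2
  exact (mul_le_mul_of_nonneg_right hz1.le (hg0 z)).trans_lt hz2

section

variable {n : ℕ} {r : Fin n → ℝ} {w : ℝ → ℝ} {a b : ℝ} {x : Fin n → ℝ}

lemma wnorm_spec (hr : ∀ j, 0 < r j) (hw : IsWeight w a b) (hab : a < b) (x : Fin n → ℝ) :
    (∃ t ∈ Icc a b, w t * gap r x t = wnorm w a b r x) ∧
      ∀ t ∈ Icc a b, w t * gap r x t ≤ wnorm w a b r x := by
  have husc : UpperSemicontinuousOn (fun t => w t * gap r x t) (Icc a b) := by
    intro t ht c hc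
    refine eventually_mul_lt_of_usc (hw.usc t ht) (φ := id) tendsto_id ?_ (gap_nonneg r x) hc
    exact (((continuous_gap hr).comp (Continuous.prodMk_right x)).tendsto t).mono_left
      nhdsWithin_le_nhds
  obtain ⟨t, ht, hmax⟩ := husc.exists_isMaxOn (nonempty_Icc.2 hab.le) isCompact_Icc
  have hgr : IsGreatest ((fun t => w t * gap r x t) '' Icc a b) (w t * gap r x t) :=
    ⟨mem_image_of_mem _ ht, by rintro _ ⟨s, hs, rfl⟩; exact hmax hs⟩
  have heq : w t * gap r x t = wnorm w a b r x := hgr.csSup_eq.symm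
  exact ⟨⟨t, ht, heq⟩, fun s hs => heq ▸ hmax hs⟩

lemma wnorm_pos (hr : ∀ j, 0 < r j) (hw : IsWeight w a b) (hab : a < b)
    (hcard : weightCardGT w a b n) (x : Fin n → ℝ) : 0 < wnorm w a b r x := by
  classical
  obtain ⟨T, hT, hT0, hsum⟩ := hcard
  have h1 : n < T.card := by
    have : ∑ t ∈ T, (if t = a ∨ t = b then (1 / 2 : ℝ) else 1) ≤ ∑ t ∈ T, 1 :=
      Finset.sum_le_sum fun t _ => by split_ifs <;> norm_num
    rw [Finset.sum_const, nsmul_one] at this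
    exact_mod_cast hsum.trans_le this
  obtain ⟨t, ht, htx⟩ := Finset.exists_mem_notMem_of_card_lt_card
    ((Finset.card_image_le (s := Finset.univ) (f := x)).trans_lt (by simpa using h1))
  refine (mul_pos ?_ (gap_pos r x (s := t) ?_)).trans_le ((wnorm_spec hr hw hab x).2 t (hT ht))
  · exact lt_of_le_of_ne (hw.nonneg t (hT ht)) (hT0 t ht).symm
  · rintro j rfl
    exact htx (Finset.mem_image_of_mem _ (Finset.mem_univ j))

lemma exists_wnorm_minimizer (hr : ∀ j, 0 < r j) (hw : IsWeight w a b) (hab : a < b) :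
    ∃ x : Fin n → ℝ, adm a b x ∧ ∀ x', adm a b x' → wnorm w a b r x ≤ wnorm w a b r x' := by
  have hcpt : IsCompact {x : Fin n → ℝ | adm a b x} := by
    have : {x : Fin n → ℝ | adm a b x} = {x | Monotone x} ∩ Set.pi univ fun _ => Icc a b := by
      ext x; simp only [adm, Set.mem_ofPred_eq, Set.mem_inter_iff, Set.mem_univ_pi]
    rw [this]
    exact (isCompact_univ_pi fun _ => isCompact_Icc).inter_left isClosed_monotone
  have hlsc : LowerSemicontinuousOn (fun x => wnorm w a b r x) {x : Fin n → ℝ | adm a b x} := by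
    intro x _ c hc
    obtain ⟨⟨t, ht, h⟩, -⟩ := wnorm_spec hr hw hab x
    have hcont : Continuous fun y : Fin n → ℝ => w t * gap r y t :=
      continuous_const.mul ((continuous_gap hr).comp (Continuous.prodMk_left t))
    refine nhdsWithin_le_nhds ?_
    filter_upwards [(hcont.tendsto x).eventually (Ioi_mem_nhds (hc.trans_eq h.symm))] with y hy
    exact lt_of_lt_of_le hy ((wnorm_spec hr hw hab y).2 t ht)
  have hne : {x : Fin n → ℝ | adm a b x}.Nonempty :=
    ⟨fun _ => a, monotone_const, fun _ => left_mem_Icc.2 hab.le⟩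
  obtain ⟨x, hx, hmin⟩ := hlsc.exists_isMinOn hne hcpt
  exact ⟨x, hx, fun x' hx' => hmin hx'⟩

lemma exists_wnorm_lt_of_direction (hr : ∀ j, 0 < r j) (hw : IsWeight w a b) (hab : a < b)
    {h : Fin n → ℝ} (hadm : ∀ᶠ ε : ℝ in 𝓝[>] 0, adm a b (x + ε • h)) {K : Set ℝ}
    (hK : IsCompact K)
    (hKM : ∀ t ∈ Icc a b, t ∈ K → w t * gap r x t < wnorm w a b r x)
    (hout : ∀ᶠ ε : ℝ in 𝓝[>] 0, ∀ t ∈ Icc a b, t ∉ K →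
      w t * gap r (x + ε • h) t < wnorm w a b r x) :
    ∃ x', adm a b x' ∧ wnorm w a b r x' < wnorm w a b r x := by
  have hin : ∀ᶠ ε : ℝ in 𝓝 0, ∀ t ∈ K ∩ Icc a b,
      w t * gap r (x + ε • h) t < wnorm w a b r x := by
    have : ∀ᶠ ε : ℝ in 𝓝 0, ∀ t ∈ K ∩ Icc a b,
        t ∈ Icc a b → w t * gap r (x + ε • h) t < wnorm w a b r x := by
      refine (hK.inter_right isClosed_Icc).eventually_forall_of_forall_eventually ?_
      rintro t ⟨htK, htI⟩
      refine eventually_inf_principal (s := {p : ℝ × ℝ | p.2 ∈ Icc a b}).1 ?_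
      refine eventually_mul_lt_of_usc (hw.usc t htI) (φ := Prod.snd)
        (g := fun p : ℝ × ℝ => gap r (x + p.1 • h) p.2) (g₀ := gap r x t) ?_ ?_
        (fun _ => gap_nonneg _ _ _) (hKM t htI htK)
      · refine tendsto_nhdsWithin_iff.2 ⟨?_, mem_inf_of_right fun p hp => hp⟩
        exact (continuous_snd.tendsto ((0 : ℝ), t)).mono_left inf_le_left
      · have hc : Continuous fun p : ℝ × ℝ => gap r (x + p.1 • h) p.2 :=
          (continuous_gap hr).comp (by fun_prop : Continuous fun p : ℝ × ℝ => (x + p.1 • h, p.2))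
        have := (hc.tendsto ((0 : ℝ), t)).mono_left (inf_le_left (b := 𝓟 {p | p.2 ∈ Icc a b}))
        simpa using this
    exact this.mono fun ε hε t ht => hε t ht ht.2
  obtain ⟨ε, h1, h2, h3⟩ := (hadm.and (hout.and (nhdsWithin_le_nhds hin))).exists
  refine ⟨x + ε • h, h1, ?_⟩
  obtain ⟨⟨t, ht, heq⟩, -⟩ := wnorm_spec hr hw hab (x + ε • h)
  rw [← heq]
  by_cases htK : t ∈ K
  · exact h3 t ⟨htK, ht⟩
  · exact h2 t ht htK

lemma eventually_adm {h : Fin n → ℝ} (hx : adm a b x)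
    (hh : ∀ l m, l ≤ m → x l = x m → h l ≤ h m) (ha : ∀ l, x l = a → 0 ≤ h l)
    (hb : ∀ l, x l = b → h l ≤ 0) : ∀ᶠ ε : ℝ in 𝓝[>] 0, adm a b (x + ε • h) := by
  have key : ∀ p q u v : ℝ, p ≤ q → (p = q → u ≤ v) →
      ∀ᶠ ε : ℝ in 𝓝[>] 0, p + ε * u ≤ q + ε * v := by
    intro p q u v hpq huv
    rcases hpq.eq_or_lt with heq | hlt
    · filter_upwards [self_mem_nhdsWithin] with ε hε
      exact add_le_add hpq (mul_le_mul_of_nonneg_left (huv heq) (le_of_lt hε))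
    · have hc : Continuous fun ε : ℝ => q + ε * v - (p + ε * u) := by fun_prop
      have := (hc.tendsto 0).eventually (lt_mem_nhds (a := 0) (by simpa using hlt))
      exact nhdsWithin_le_nhds (this.mono fun ε hε => by linarith)
  have h1 : ∀ᶠ ε : ℝ in 𝓝[>] 0, ∀ l m, l ≤ m → x l + ε * h l ≤ x m + ε * h m := by
    refine eventually_all.2 fun l => eventually_all.2 fun m => ?_
    by_cases hlm : l ≤ m
    · exact (key _ _ _ _ (hx.1 hlm) (hh l m hlm)).mono fun _ h _ => h
    · exact Eventually.of_forall fun _ h => absurd h hlm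
  have h2 : ∀ᶠ ε : ℝ in 𝓝[>] 0, ∀ l, a + ε * 0 ≤ x l + ε * h l :=
    eventually_all.2 fun l => key _ _ _ _ (hx.2 l).1 fun h => ha l h.symm
  have h3 : ∀ᶠ ε : ℝ in 𝓝[>] 0, ∀ l, x l + ε * h l ≤ b + ε * 0 :=
    eventually_all.2 fun l => key _ _ _ _ (hx.2 l).2 (hb l)
  filter_upwards [h1, h2, h3] with ε h1 h2 h3
  exact ⟨fun l m hlm => h1 l m hlm, fun l => ⟨by simpa using h2 l, by simpa using h3 l⟩⟩

lemma mul_gap_lt_of_prod_lt {x' : Fin n → ℝ} {t M : ℝ} (S : Finset (Fin n))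
    (hx : ∀ l, l ∉ S → x' l = x l)
    (hS : ∏ l ∈ S, |t - x' l| ^ r l < ∏ l ∈ S, |t - x l| ^ r l) (hM : 0 < M) (hw : 0 ≤ w t)
    (hle : w t * gap r x t ≤ M) : w t * gap r x' t < M := by
  have hR : ∏ l ∈ Sᶜ, |t - x' l| ^ r l = ∏ l ∈ Sᶜ, |t - x l| ^ r l :=
    Finset.prod_congr rfl fun l hl => by rw [hx l (Finset.mem_compl.1 hl)]
  have hR0 : 0 ≤ ∏ l ∈ Sᶜ, |t - x l| ^ r l :=
    Finset.prod_nonneg fun _ _ => Real.rpow_nonneg (abs_nonneg _) _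
  unfold gap at hle ⊢
  rw [← Finset.prod_mul_prod_compl S, mul_left_comm] at hle ⊢
  rw [hR]
  rcases (mul_nonneg hw hR0).eq_or_lt with h0 | h0
  · rw [← h0, mul_zero]; exact hM
  · exact (mul_lt_mul_of_pos_right hS h0).trans_le hle

lemma exists_closedBall_mul_gap_lt (hr : ∀ j, 0 < r j) (hw : IsWeight w a b) {M c : ℝ}
    (hc : c ∈ Icc a b) (h : w c * gap r x c < M) :
    ∃ δ > 0, ∀ t ∈ Icc a b, |t - c| ≤ δ → w t * gap r x t < M := by
  have h1 : ∀ᶠ t in 𝓝[Icc a b] c, w t * gap r x t < M := by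
    refine eventually_mul_lt_of_usc (hw.usc c hc) (φ := id) tendsto_id ?_ (gap_nonneg r x) h
    exact (((continuous_gap hr).comp (Continuous.prodMk_right x)).tendsto c).mono_left
      nhdsWithin_le_nhds
  obtain ⟨δ, hδ, H⟩ := Metric.nhds_basis_closedBall.eventually_iff.1
    (eventually_nhdsWithin_iff.1 h1)
  exact ⟨δ, hδ, fun t ht htc => H (by simpa [Real.dist_eq] using htc) ht⟩

lemma rpow_mul_rpow_lt_of_spread {p q A B ε : ℝ} (hp : 0 < p) (hq : 0 < q) (hB : 0 < B)
    (hBA : B ≤ A) (hε : 0 < ε) (hεB : ε / q < B) :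
    (A + ε / p) ^ p * (B - ε / q) ^ q < A ^ p * B ^ q := by
  have hA := hB.trans_le hBA
  have h1 : (A + ε / p) ^ p ≤ A ^ p * Real.exp (ε / A) := by
    have : A + ε / p ≤ A * Real.exp (ε / A / p) := by
      have := mul_le_mul_of_nonneg_left (Real.add_one_le_exp (ε / A / p)) hA.le
      refine le_trans (le_of_eq ?_) this
      field_simp; ring
    calc (A + ε / p) ^ p ≤ (A * Real.exp (ε / A / p)) ^ p :=
          Real.rpow_le_rpow (by positivity) this hp.le
      _ = A ^ p * Real.exp (ε / A) := by
          rw [Real.mul_rpow hA.le (Real.exp_pos _).le, ← Real.exp_mul,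
            div_mul_cancel₀ _ hp.ne']
  have h2 : (B - ε / q) ^ q < B ^ q * Real.exp (-(ε / B)) := by
    have : B - ε / q < B * Real.exp (-(ε / B) / q) := by
      have := mul_lt_mul_of_pos_left
        (Real.add_one_lt_exp (x := -(ε / B) / q) (by
          have : 0 < ε / B / q := by positivity
          rw [neg_div]; exact (neg_lt_zero.2 this).ne)) hB
      refine lt_of_eq_of_lt ?_ this
      field_simp; ring
    calc (B - ε / q) ^ q < (B * Real.exp (-(ε / B) / q)) ^ q :=
          Real.rpow_lt_rpow (by linarith) this hq
      _ = B ^ q * Real.exp (-(ε / B)) := by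
          rw [Real.mul_rpow hB.le (Real.exp_pos _).le, ← Real.exp_mul,
            div_mul_cancel₀ _ hq.ne']
  have h3 : Real.exp (ε / A) * Real.exp (-(ε / B)) ≤ 1 := by
    rw [← Real.exp_add, Real.exp_le_one_iff]
    have := div_le_div_of_nonneg_left hε.le hB hBA
    linarith
  have hAp : 0 < A ^ p := Real.rpow_pos_of_pos hA _
  have hBq : 0 < B ^ q := Real.rpow_pos_of_pos hB _
  calc (A + ε / p) ^ p * (B - ε / q) ^ q
      ≤ (A ^ p * Real.exp (ε / A)) * (B - ε / q) ^ q :=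
        mul_le_mul_of_nonneg_right h1 (Real.rpow_nonneg (by linarith) _)
    _ < (A ^ p * Real.exp (ε / A)) * (B ^ q * Real.exp (-(ε / B))) :=
        mul_lt_mul_of_pos_left h2 (by positivity)
    _ = (A ^ p * B ^ q) * (Real.exp (ε / A) * Real.exp (-(ε / B))) := by ring
    _ ≤ A ^ p * B ^ q := mul_le_of_le_one_right (by positivity) h3

lemma exists_wnorm_lt_of_move_right (hr : ∀ j, 0 < r j) (hw : IsWeight w a b) (hab : a < b)
    (hM : 0 < wnorm w a b r x) (hx : adm a b x) {j : Fin n} (hj : ∀ l, j < l → x j < x l)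
    (hjb : x j < b) (hlt : ∀ t ∈ Icc a b, t ≤ x j → w t * gap r x t < wnorm w a b r x) :
    ∃ x', adm a b x' ∧ wnorm w a b r x' < wnorm w a b r x := by
  classical
  obtain ⟨δ, hδ, hball⟩ := exists_closedBall_mul_gap_lt hr hw (hx.2 j) (hlt _ (hx.2 j) le_rfl)
  have hle : ∀ l, 0 ≤ (Pi.single j 1 : Fin n → ℝ) l := by
    intro l
    by_cases h : l = j
    · subst h; simp
    · rw [Pi.single_eq_of_ne h]
  refine exists_wnorm_lt_of_direction hr hw hab (h := Pi.single j 1) (K := Icc a (x j + δ))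
    (eventually_adm hx ?_ ?_ ?_) isCompact_Icc ?_ ?_
  · intro l m hlm heq
    by_cases h : l = j
    · subst h
      rcases hlm.eq_or_lt with rfl | h'
      · rfl
      · exact absurd heq (hj m h').ne
    · rw [Pi.single_eq_of_ne h]; exact hle m
  · exact fun l _ => hle l
  · intro l hl
    rw [Pi.single_eq_of_ne]; rintro rfl; exact hjb.ne hl
  · intro t ht htK
    rcases le_total t (x j) with h | h
    · exact hlt t ht h
    · exact hball t ht (abs_le.2 ⟨by linarith, by linarith [htK.2]⟩)
  · filter_upwards [self_mem_nhdsWithin, nhdsWithin_le_nhds (Iio_mem_nhds hδ)] with ε h0 h1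
    intro t ht htK
    have htj : x j + δ < t := not_le.1 fun h => htK ⟨ht.1, h⟩
    simp only [mem_Ioi, mem_Iio] at h0 h1
    refine mul_gap_lt_of_prod_lt {j} (fun l hl => ?_) ?_ hM (hw.nonneg t ht)
      ((wnorm_spec hr hw hab x).2 t ht)
    · simp [Pi.single_eq_of_ne (Finset.notMem_singleton.1 hl)]
    · simp only [Finset.prod_singleton, Pi.add_apply, Pi.smul_apply, Pi.single_eq_same,
        smul_eq_mul, mul_one]
      rw [abs_of_pos (by linarith), abs_of_pos (by linarith)]
      exact Real.rpow_lt_rpow (by linarith) (by linarith) (hr j)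

lemma exists_wnorm_lt_of_move_left (hr : ∀ j, 0 < r j) (hw : IsWeight w a b) (hab : a < b)
    (hM : 0 < wnorm w a b r x) (hx : adm a b x) {i : Fin n} (hi : ∀ l, l < i → x l < x i)
    (hia : a < x i) (hlt : ∀ t ∈ Icc a b, x i ≤ t → w t * gap r x t < wnorm w a b r x) :
    ∃ x', adm a b x' ∧ wnorm w a b r x' < wnorm w a b r x := by
  classical
  obtain ⟨δ, hδ, hball⟩ := exists_closedBall_mul_gap_lt hr hw (hx.2 i) (hlt _ (hx.2 i) le_rfl)
  have hle : ∀ l, (Pi.single i (-1) : Fin n → ℝ) l ≤ 0 := by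
    intro l
    by_cases h : l = i
    · subst h; simp
    · rw [Pi.single_eq_of_ne h]
  refine exists_wnorm_lt_of_direction hr hw hab (h := Pi.single i (-1)) (K := Icc (x i - δ) b)
    (eventually_adm hx ?_ ?_ ?_) isCompact_Icc ?_ ?_
  · intro l m hlm heq
    by_cases h : m = i
    · subst h
      rcases hlm.eq_or_lt with rfl | h'
      · rfl
      · exact absurd heq (hi l h').ne
    · rw [Pi.single_eq_of_ne h]; exact hle l
  · intro l hl
    rw [Pi.single_eq_of_ne]; rintro rfl; exact hia.ne' hl
  · exact fun l _ => hle l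
  · intro t ht htK
    rcases le_total (x i) t with h | h
    · exact hlt t ht h
    · exact hball t ht (abs_le.2 ⟨by linarith [htK.1], by linarith⟩)
  · filter_upwards [self_mem_nhdsWithin, nhdsWithin_le_nhds (Iio_mem_nhds hδ)] with ε h0 h1
    intro t ht htK
    have hti : t < x i - δ := not_le.1 fun h => htK ⟨h, ht.2⟩
    simp only [mem_Ioi, mem_Iio] at h0 h1
    refine mul_gap_lt_of_prod_lt {i} (fun l hl => ?_) ?_ hM (hw.nonneg t ht)
      ((wnorm_spec hr hw hab x).2 t ht)
    · simp [Pi.single_eq_of_ne (Finset.notMem_singleton.1 hl)]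
    · simp only [Finset.prod_singleton, Pi.add_apply, Pi.smul_apply, Pi.single_eq_same,
        smul_eq_mul]
      rw [abs_of_neg (by linarith), abs_of_neg (by linarith)]
      exact Real.rpow_lt_rpow (by linarith) (by linarith) (hr i)

lemma exists_wnorm_lt_of_spread (hr : ∀ j, 0 < r j) (hw : IsWeight w a b) (hab : a < b)
    (hM : 0 < wnorm w a b r x) (hx : adm a b x) {i j : Fin n} (hij : i < j)
    (hi : ∀ l, l < i → x l < x i) (hj : ∀ l, j < l → x j < x l) (hia : a < x i) (hjb : x j < b)
    (hlt : ∀ t ∈ Icc a b, x i ≤ t → t ≤ x j → w t * gap r x t < wnorm w a b r x) :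
    ∃ x', adm a b x' ∧ wnorm w a b r x' < wnorm w a b r x := by
  classical
  have hxij : x i ≤ x j := hx.1 hij.le
  obtain ⟨δ₁, hδ₁, hball₁⟩ :=
    exists_closedBall_mul_gap_lt hr hw (hx.2 i) (hlt _ (hx.2 i) le_rfl hxij)
  obtain ⟨δ₂, hδ₂, hball₂⟩ :=
    exists_closedBall_mul_gap_lt hr hw (hx.2 j) (hlt _ (hx.2 j) hxij le_rfl)
  obtain ⟨h, hh⟩ : ∃ h : Fin n → ℝ,
    ∀ l, h l = if l = i then -(1 / r i) else if l = j then 1 / r j else 0 := ⟨_, fun _ => rfl⟩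
  have hri : 0 < 1 / r i := one_div_pos.2 (hr i)
  have hrj : 0 < 1 / r j := one_div_pos.2 (hr j)
  have hhi : h i = -(1 / r i) := by simp [hh]
  have hhj : h j = 1 / r j := by simp [hh, hij.ne']
  refine exists_wnorm_lt_of_direction hr hw hab (h := h) (K := Icc (x i - δ₁) (x j + δ₂))
    (eventually_adm hx ?_ ?_ ?_) isCompact_Icc ?_ ?_
  · intro l m hlm heq
    rcases hlm.eq_or_lt with rfl | hlm
    · rfl
    have hm : m ≠ i := by rintro rfl; exact (hi l hlm).ne heq
    have hl : l ≠ j := by rintro rfl; exact (hj m hlm).ne heq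
    rw [hh, hh, if_neg hm, if_neg hl]
    split_ifs <;> linarith
  · intro l hl
    have : l ≠ i := by rintro rfl; exact hia.ne' hl
    rw [hh, if_neg this]
    split_ifs <;> linarith
  · intro l hl
    have : l ≠ j := by rintro rfl; exact hjb.ne hl
    rw [hh, if_neg this]
    split_ifs <;> linarith
  · intro t ht htK
    rcases le_total (x i) t with h1 | h1
    · rcases le_total t (x j) with h2 | h2
      · exact hlt t ht h1 h2
      · exact hball₂ t ht (abs_le.2 ⟨by linarith, by linarith [htK.2]⟩)
    · exact hball₁ t ht (abs_le.2 ⟨by linarith [htK.1], by linarith⟩)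
  · filter_upwards [self_mem_nhdsWithin,
      nhdsWithin_le_nhds (Iio_mem_nhds (mul_pos hδ₁ (hr i))),
      nhdsWithin_le_nhds (Iio_mem_nhds (mul_pos hδ₂ (hr j)))] with ε h0 h1 h2
    intro t ht htK
    simp only [mem_Ioi, mem_Iio] at h0 h1 h2
    rw [← div_lt_iff₀ (hr i)] at h1
    rw [← div_lt_iff₀ (hr j)] at h2
    have hεi : 0 < ε / r i := div_pos h0 (hr i)
    have hεj : 0 < ε / r j := div_pos h0 (hr j)
    refine mul_gap_lt_of_prod_lt {i, j} (fun l hl => ?_) ?_ hM (hw.nonneg t ht)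
      ((wnorm_spec hr hw hab x).2 t ht)
    · simp only [Finset.mem_insert, Finset.mem_singleton, not_or] at hl
      simp [hh, hl.1, hl.2]
    · rw [Finset.prod_pair hij.ne, Finset.prod_pair hij.ne]
      simp only [Pi.add_apply, Pi.smul_apply, smul_eq_mul, hhi, hhj, mul_neg, mul_one_div]
      rcases lt_or_ge t (x i - δ₁) with h3 | h3
      · have := rpow_mul_rpow_lt_of_spread (A := x j - t) (B := x i - t) (hr j) (hr i)
          (by linarith) (by linarith) h0 (by linarith)
        rw [abs_of_neg (by linarith), abs_of_neg (by linarith), abs_of_neg (by linarith),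
          abs_of_neg (by linarith)]
        convert this using 1
        · rw [mul_comm]; congr 2 <;> ring
        · rw [mul_comm]; congr 2 <;> ring
      · have h4 : x j + δ₂ < t := not_le.1 fun h => htK ⟨h3, h⟩
        have := rpow_mul_rpow_lt_of_spread (A := t - x i) (B := t - x j) (hr i) (hr j)
          (by linarith) (by linarith) h0 (by linarith)
        rw [abs_of_pos (by linarith), abs_of_pos (by linarith), abs_of_pos (by linarith),
          abs_of_pos (by linarith)]
        convert this using 1
        congr 2 <;> ring

lemma exists_right_mover (hx : adm a b x) (k : Fin (n + 1)) :
    (∀ m : Fin n, k ≤ m.castSucc → x m = b) ∨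
      ∃ j : Fin n, k ≤ j.castSucc ∧ (∀ l, j < l → x j < x l) ∧ x j < b ∧
        ∀ m : Fin n, k ≤ m.castSucc → x j ≤ x m := by
  classical
  refine or_iff_not_imp_left.2 fun hne => ?_
  push Not at hne
  obtain ⟨m, hkm, hmb⟩ := hne
  obtain ⟨m₀, hm₀, hmin⟩ := (Finset.univ.filter fun m : Fin n => k ≤ m.castSucc).exists_min_image id
    ⟨m, by simpa using hkm⟩
  obtain ⟨j, hj, hmax⟩ := (Finset.univ.filter fun l => x l = x m₀).exists_max_image id
    ⟨m₀, by simp⟩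
  simp only [Finset.mem_filter, Finset.mem_univ, true_and, id] at hm₀ hmin hj hmax
  refine ⟨j, hm₀.trans (Fin.castSucc_le_castSucc_iff.2 (hmax _ rfl)), fun l hl => ?_, ?_, ?_⟩
  · refine lt_of_le_of_ne (hx.1 hl.le) fun h => ?_
    exact absurd (hmax l (h.symm.trans hj)) (not_le.2 hl)
  · rw [hj]
    exact (hx.1 (hmin m hkm)).trans_lt (lt_of_le_of_ne (hx.2 m).2 hmb)
  · intro l hl
    rw [hj]
    exact hx.1 (hmin l hl)

lemma exists_left_mover (hx : adm a b x) (k : Fin (n + 1)) :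
    (∀ m : Fin n, m.castSucc < k → x m = a) ∨
      ∃ i : Fin n, i.castSucc < k ∧ (∀ l, l < i → x l < x i) ∧ a < x i ∧
        ∀ m : Fin n, m.castSucc < k → x m ≤ x i := by
  classical
  refine or_iff_not_imp_left.2 fun hne => ?_
  push Not at hne
  obtain ⟨m, hkm, hma⟩ := hne
  obtain ⟨m₀, hm₀, hmax⟩ := (Finset.univ.filter fun m : Fin n => m.castSucc < k).exists_max_image id
    ⟨m, by simpa using hkm⟩
  obtain ⟨i, hi, hmin⟩ := (Finset.univ.filter fun l => x l = x m₀).exists_min_image id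
    ⟨m₀, by simp⟩
  simp only [Finset.mem_filter, Finset.mem_univ, true_and, id] at hm₀ hmax hi hmin
  refine ⟨i, (Fin.castSucc_le_castSucc_iff.2 (hmin _ rfl)).trans_lt hm₀, fun l hl => ?_, ?_, ?_⟩
  · refine lt_of_le_of_ne (hx.1 hl.le) fun h => ?_
    exact absurd (hmin l (h.trans hi)) (not_le.2 hl)
  · rw [hi]
    exact (lt_of_le_of_ne (hx.2 m).1 (Ne.symm hma)).trans_le (hx.1 (hmax m hkm))
  · intro l hl
    rw [hi]
    exact hx.1 (hmax l hl)

/-- A minimizer attains its norm in each of the `n + 1` gaps determined by its nodes. -/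
theorem exists_mem_gap_of_minimizer (hr : ∀ j, 0 < r j) (hw : IsWeight w a b) (hab : a < b)
    (hM : 0 < wnorm w a b r x) (hx : adm a b x)
    (hmin : ∀ x', adm a b x' → wnorm w a b r x ≤ wnorm w a b r x') (k : Fin (n + 1)) :
    ∃ t ∈ Icc a b, w t * gap r x t = wnorm w a b r x ∧
      ∀ j : Fin n, (j.castSucc < k → x j < t) ∧ (k ≤ j.castSucc → t < x j) := by
  by_contra! hno
  suffices ∃ x', adm a b x' ∧ wnorm w a b r x' < wnorm w a b r x by
    obtain ⟨x', h1, h2⟩ := this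
    exact absurd (hmin x' h1) (not_le.2 h2)
  have hlt : ∀ t ∈ Icc a b, (∀ m : Fin n, m.castSucc < k → x m ≤ t) →
      (∀ m : Fin n, k ≤ m.castSucc → t ≤ x m) → w t * gap r x t < wnorm w a b r x := by
    intro t ht h1 h2
    refine lt_of_le_of_ne ((wnorm_spec hr hw hab x).2 t ht) fun heq => ?_
    have hnode : ∀ m, x m ≠ t := by
      rintro m rfl
      rw [gap_node hr, mul_zero] at heq
      exact hM.ne heq
    obtain ⟨m, hm⟩ := hno t ht heq
    by_cases hmk : m.castSucc < k
    · have := hm fun _ => lt_of_le_of_ne (h1 m hmk) (hnode m)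
      exact absurd hmk (not_lt.2 this.1)
    · have := hm fun h => absurd h hmk
      exact absurd (lt_of_le_of_ne (h2 m this.1) (hnode m).symm) (not_lt.2 this.2)
  rcases exists_left_mover hx k with hL | ⟨i, hik, hi, hia, himax⟩ <;>
    rcases exists_right_mover hx k with hR | ⟨j, hjk, hj, hjb, hjmin⟩
  · obtain ⟨t, ht, heq⟩ := (wnorm_spec hr hw hab x).1
    exact absurd heq (hlt t ht (fun m hm => hL m hm ▸ ht.1) (fun m hm => hR m hm ▸ ht.2)).ne
  · exact exists_wnorm_lt_of_move_right hr hw hab hM hx hj hjb fun t ht htj =>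
      hlt t ht (fun m hm => hL m hm ▸ ht.1) fun m hm => htj.trans (hjmin m hm)
  · exact exists_wnorm_lt_of_move_left hr hw hab hM hx hi hia fun t ht hti =>
      hlt t ht (fun m hm => (himax m hm).trans hti) fun m hm => hR m hm ▸ ht.2
  · exact exists_wnorm_lt_of_spread hr hw hab hM hx
      (Fin.castSucc_lt_castSucc_iff.1 (hik.trans_le hjk)) hi hj hia hjb fun t ht hti htj =>
      hlt t ht (fun m hm => (himax m hm).trans hti) fun m hm => htj.trans (hjmin m hm)

theorem exists_interlacing_of_minimizer (hr : ∀ j, 0 < r j) (hw : IsWeight w a b) (hab : a < b)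
    (hM : 0 < wnorm w a b r x) (hx : adm a b x)
    (hmin : ∀ x', adm a b x' → wnorm w a b r x ≤ wnorm w a b r x') :
    ∃ t : Fin (n + 1) → ℝ, a ≤ t 0 ∧ t (Fin.last n) ≤ b ∧
      (∀ j : Fin n, t j.castSucc < x j ∧ x j < t j.succ) ∧
      ∀ k, w (t k) * gap r x (t k) = wnorm w a b r x := by
  choose t ht heq hgap using exists_mem_gap_of_minimizer hr hw hab hM hx hmin
  exact ⟨t, (ht 0).1, (ht _).2, fun j => ⟨(hgap _ j).2 le_rfl, (hgap _ j).1 j.castSucc_lt_succ⟩, heq⟩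

/-- Interlacing equioscillation forces strict optimality. -/
theorem eq_of_wnorm_le_of_equioscillation (hr : ∀ j, 0 < r j) (hw : IsWeight w a b) (hab : a < b)
    (hM : 0 < wnorm w a b r x) {t : Fin (n + 1) → ℝ} (hta : a ≤ t 0) (htb : t (Fin.last n) ≤ b)
    (hxt : ∀ j : Fin n, t j.castSucc < x j ∧ x j < t j.succ)
    (heq : ∀ k, w (t k) * gap r x (t k) = wnorm w a b r x)
    {y : Fin n → ℝ} (hy : Monotone y) (hle : wnorm w a b r y ≤ wnorm w a b r x) : y = x := by
  have ht : StrictMono t := Fin.strictMono_iff_lt_succ.2 fun j => (hxt j).1.trans (hxt j).2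
  refine eq_of_gap_le_of_interlacing hr hy hxt fun k => ?_
  have hk : t k ∈ Icc a b :=
    ⟨hta.trans (ht.monotone (Fin.zero_le k)), (ht.monotone (Fin.le_last k)).trans htb⟩
  have hpos : 0 < w (t k) := by
    refine lt_of_le_of_ne (hw.nonneg _ hk) fun h => ?_
    have := heq k
    rw [← h, zero_mul] at this
    exact hM.ne this
  exact le_of_mul_le_mul_left
    ((((wnorm_spec hr hw hab y).2 _ hk).trans hle).trans_eq (heq k).symm) hpos

end

theorem statement16 (n : ℕ) (hn : 0 < n) (r : Fin n → ℝ) (hr : ∀ j, 0 < r j)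
    (a b : ℝ) (hab : a < b)
    (w : ℝ → ℝ) (hw0 : ∀ t ∈ Icc a b, 0 ≤ w t)
    (husc : UpperSemicontinuousOn w (Icc a b)) (hcard : weightCardGT w a b n) :
    ∃ xs : Fin n → ℝ, adm a b xs ∧ StrictMono xs ∧ (∀ j, xs j ∈ Ioo a b) ∧
      (∀ x : Fin n → ℝ, adm a b x → wnorm w a b r xs ≤ wnorm w a b r x) ∧
      (∀ x : Fin n → ℝ, adm a b x →
        (∀ x' : Fin n → ℝ, adm a b x' → wnorm w a b r x ≤ wnorm w a b r x') → x = xs) ∧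
      (∀ x : Fin n → ℝ, adm a b x →
        (x = xs ↔ ∃ t : Fin (n + 1) → ℝ, a ≤ t 0 ∧ t (Fin.last n) ≤ b ∧
          (∀ j : Fin n, t j.castSucc < x j ∧ x j < t j.succ) ∧
          (∀ k, w (t k) * gap r x (t k) = wnorm w a b r x))) := by
  have hw : IsWeight w a b := ⟨hw0, husc⟩
  obtain ⟨xs, hxs, hmin⟩ := exists_wnorm_minimizer hr hw hab (n := n)
  have hosc := exists_interlacing_of_minimizer hr hw hab (wnorm_pos hr hw hab hcard xs) hxs hmin
  obtain ⟨t, hta, htb, hxt, heq⟩ := hosc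
  have ht : StrictMono t := Fin.strictMono_iff_lt_succ.2 fun j => (hxt j).1.trans (hxt j).2
  refine ⟨xs, hxs, fun i j hij => ?_, fun j => ⟨?_, ?_⟩, hmin, fun x hx hx' => ?_, fun x hx =>
    ⟨?_, ?_⟩⟩
  · exact ((hxt i).2.trans_le (ht.monotone (by simpa [Fin.le_def] using hij))).trans (hxt j).1
  · exact (hta.trans (ht.monotone (Fin.zero_le _))).trans_lt (hxt j).1
  · exact (hxt j).2.trans_le ((ht.monotone (Fin.le_last _)).trans htb)
  · exact eq_of_wnorm_le_of_equioscillation hr hw hab (wnorm_pos hr hw hab hcard xs) hta htb hxt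
      heq hx.1 (hx' xs hxs)
  · rintro rfl
    exact ⟨t, hta, htb, hxt, heq⟩
  · rintro ⟨s, hsa, hsb, hxs', hseq⟩
    exact (eq_of_wnorm_le_of_equioscillation hr hw hab (wnorm_pos hr hw hab hcard x) hsa hsb hxs'
      hseq hxs.1 (hmin x hx)).symm
end
end

section
/- Let k, n ∈ ℕ, let a₁ < b₁ < a₂ < b₂ < ⋯ < a_k < b_k be real numbers, let E := ⋃_{ℓ=1}^k [a_ℓ, b_ℓ], let r₁,…,rₙ > 0, and let w : ℝ → [0,∞) be an upper semicontinuous weight that is nonzero on a subset of E of weighted cardinality exceeding n (points in the interior of [a₁, b_k] counted with weight 1, the points a₁ and b_k with weight 1/2). Define the restricted Bojanov–Chebyshev constant R := inf over node systems x₁ ≤ ⋯ ≤ xₙ with all xⱼ ∈ E of sup_{t ∈ E} w(t)·∏_{j=1}^n |t − xⱼ|^{rⱼ}, and the unrestricted constant C := inf over node systems x₁ ≤ ⋯ ≤ xₙ with xⱼ ∈ ℝ of the same quantity. Then C ≤ R ≤ C(k,r)·C, where C(k,r) := 2^M with M := max{ Σ_{i ∈ A} r_i : A ⊆ {1,…,n},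 |A| ≤ k−1 }. In particular, for r₁ = ⋯ = rₙ = 1 (ordinary monic degree-n polynomials), C ≤ R ≤ 2^{k−1}·C, independently of n. -/
open Set Filter

noncomputable section

/-- The `w`-weighted sup norm over a set `E` of the GAP with node system `x`. -/
def enorm (w : ℝ → ℝ) (E : Set ℝ) {n : ℕ} (r x : Fin n → ℝ) : ℝ :=
  sSup ((fun t => w t * ∏ j, |t - x j| ^ r j) '' E)

/-- The restricted Bojanov–Chebyshev constant of `E` (nodes in `E`). -/
def RconstE (w : ℝ → ℝ) (E : Set ℝ) {n : ℕ} (r : Fin n → ℝ) : ℝ :=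
  sInf {v : ℝ | ∃ x : Fin n → ℝ, Monotone x ∧ (∀ j, x j ∈ E) ∧ v = enorm w E r x}

/-- The unrestricted Bojanov–Chebyshev constant of `E` (nodes anywhere in `ℝ`). -/
def CconstE (w : ℝ → ℝ) (E : Set ℝ) {n : ℕ} (r : Fin n → ℝ) : ℝ :=
  sInf {v : ℝ | ∃ x : Fin n → ℝ, Monotone x ∧ v = enorm w E r x}

/-- Moving two nodes apart while preserving their weighted centre of mass does not increase the
two-node product at a point to the right of both. -/
theorem rpow_mul_rpow_le_of_spread_right {r s ε x y t : ℝ} (hr : 0 < r) (hs : 0 < s) (hε : 0 < ε)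
    (hxy : x ≤ y) (ht : y + ε / s ≤ t) :
    |t - (x - ε / r)| ^ r * |t - (y + ε / s)| ^ s ≤ |t - x| ^ r * |t - y| ^ s := by
  have hεs : 0 < ε / s := by positivity
  have hεr : 0 < ε / r := by positivity
  have hy : 0 < t - y := by linarith
  have hx : 0 < t - x := by linarith
  rw [abs_of_pos hx, abs_of_pos hy, abs_of_nonneg (by linarith : 0 ≤ t - (y + ε / s)),
    abs_of_pos (by linarith : 0 < t - (x - ε / r))]
  have h₁ : (t - (x - ε / r)) ^ r ≤ (t - x) ^ r * Real.exp (ε / (t - x)) := by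
    have h : t - (x - ε / r) ≤ (t - x) * Real.exp (ε / (t - x) / r) := by
      have := mul_le_mul_of_nonneg_left (Real.add_one_le_exp (ε / (t - x) / r)) hx.le
      refine le_trans (le_of_eq ?_) this
      field_simp
      ring
    calc (t - (x - ε / r)) ^ r ≤ ((t - x) * Real.exp (ε / (t - x) / r)) ^ r :=
          Real.rpow_le_rpow (by linarith) h hr.le
      _ = (t - x) ^ r * Real.exp (ε / (t - x)) := by
          rw [Real.mul_rpow hx.le (Real.exp_pos _).le, ← Real.exp_mul, div_mul_cancel₀ _ hr.ne']
  have h₂ : (t - (y + ε / s)) ^ s ≤ (t - y) ^ s * Real.exp (-(ε / (t - y))) := by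
    have h : t - (y + ε / s) ≤ (t - y) * Real.exp (-(ε / (t - y)) / s) := by
      have := mul_le_mul_of_nonneg_left (Real.add_one_le_exp (-(ε / (t - y)) / s)) hy.le
      refine le_trans (le_of_eq ?_) this
      field_simp
      ring
    calc (t - (y + ε / s)) ^ s ≤ ((t - y) * Real.exp (-(ε / (t - y)) / s)) ^ s :=
          Real.rpow_le_rpow (by linarith) h hs.le
      _ = (t - y) ^ s * Real.exp (-(ε / (t - y))) := by
          rw [Real.mul_rpow hy.le (Real.exp_pos _).le, ← Real.exp_mul, div_mul_cancel₀ _ hs.ne']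
  have h₃ : Real.exp (ε / (t - x)) * Real.exp (-(ε / (t - y))) ≤ 1 := by
    rw [← Real.exp_add, Real.exp_le_one_iff]
    have : ε / (t - x) ≤ ε / (t - y) := by gcongr
    linarith
  calc (t - (x - ε / r)) ^ r * (t - (y + ε / s)) ^ s
      ≤ ((t - x) ^ r * Real.exp (ε / (t - x))) * ((t - y) ^ s * Real.exp (-(ε / (t - y)))) :=
        mul_le_mul h₁ h₂ (Real.rpow_nonneg (by linarith) _) (by positivity)
    _ = (t - x) ^ r * (t - y) ^ s * (Real.exp (ε / (t - x)) * Real.exp (-(ε / (t - y)))) := by ring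
    _ ≤ (t - x) ^ r * (t - y) ^ s := mul_le_of_le_one_right (by positivity) h₃

theorem rpow_mul_rpow_le_of_spread {r s ε x y t : ℝ} (hr : 0 < r) (hs : 0 < s) (hε : 0 < ε)
    (hxy : x ≤ y) (ht : t ≤ x - ε / r ∨ y + ε / s ≤ t) :
    |t - (x - ε / r)| ^ r * |t - (y + ε / s)| ^ s ≤ |t - x| ^ r * |t - y| ^ s := by
  rcases ht with ht | ht
  · have h := rpow_mul_rpow_le_of_spread_right hs hr hε (neg_le_neg hxy)
      (t := -t) (by linarith)
    rw [mul_comm, mul_comm (|t - x| ^ r)]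
    convert h using 3 <;> rw [← abs_neg] <;> congr 1 <;> ring
  · exact rpow_mul_rpow_le_of_spread_right hr hs hε hxy ht

/-- One step of the separation procedure: if two nodes lie in a common complementary interval of
`E`, then spreading the outermost nodes in it puts one more node into `E`. -/
theorem exists_ncard_notMem_lt {E : Set ℝ} {n : ℕ} {r x : Fin n → ℝ} (hr : ∀ j, 0 < r j)
    (hx : Monotone x) {u v : ℝ} (hu : u ∈ E) (hv : v ∈ E) (huv : ∀ e ∈ E, e ≤ u ∨ v ≤ e)
    {p q : Fin n} (hpq : p < q) (hp : u < x p) (hq : x q < v) :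
    ∃ y : Fin n → ℝ, Monotone y ∧
      (∀ j, y j = x j ∨ y j ∈ Icc u v) ∧
      {j | y j ∉ E}.ncard < {j | x j ∉ E}.ncard ∧
      ∀ t ∈ E, ∏ j, |t - y j| ^ r j ≤ ∏ j, |t - x j| ^ r j := by
  classical
  let S : Finset (Fin n) := Finset.univ.filter fun j => x j ∈ Ioo u v
  have hS : ∀ j, j ∈ S ↔ u < x j ∧ x j < v := fun j => by simp [S]
  have hpS : p ∈ S := (hS p).2 ⟨hp, (hx hpq.le).trans_lt hq⟩
  have hqS : q ∈ S := (hS q).2 ⟨hp.trans_le (hx hpq.le), hq⟩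
  obtain ⟨i, hiS, hi⟩ : ∃ i ∈ S, ∀ j ∈ S, i ≤ j :=
    ⟨S.min' ⟨p, hpS⟩, S.min'_mem _, fun j hj => S.min'_le j hj⟩
  obtain ⟨l, hlS, hl⟩ : ∃ l ∈ S, ∀ j ∈ S, j ≤ l :=
    ⟨S.max' ⟨p, hpS⟩, S.max'_mem _, fun j hj => S.le_max' j hj⟩
  have hil : i < l := (hi p hpS).trans_lt (hpq.trans_le (hl q hqS))
  obtain ⟨hui, hiv⟩ := (hS i).1 hiS
  obtain ⟨hul, hlv⟩ := (hS l).1 hlS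
  have hri := hr i
  have hrl := hr l
  obtain ⟨ε, hε, hεi, hεl, hend⟩ : ∃ ε, 0 < ε ∧ ε / r i ≤ x i - u ∧ ε / r l ≤ v - x l ∧
      (x i - ε / r i = u ∨ x l + ε / r l = v) := by
    refine ⟨min ((x i - u) * r i) ((v - x l) * r l), lt_min (mul_pos (by linarith) hri)
      (mul_pos (by linarith) hrl), ?_, ?_, ?_⟩
    · rw [div_le_iff₀ hri]; exact min_le_left _ _
    · rw [div_le_iff₀ hrl]; exact min_le_right _ _
    · rcases min_choice ((x i - u) * r i) ((v - x l) * r l) with h | h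
      · left; rw [h, mul_div_cancel_right₀ _ hri.ne']; ring
      · right; rw [h, mul_div_cancel_right₀ _ hrl.ne']; ring
  have hεi0 : 0 < ε / r i := by positivity
  have hεl0 : 0 < ε / r l := by positivity
  let y : Fin n → ℝ := fun j => if j = i then x i - ε / r i else
    if j = l then x l + ε / r l else x j
  have hyi : y i = x i - ε / r i := by simp [y]
  have hyl : y l = x l + ε / r l := by simp [y, hil.ne']
  have hyj : ∀ j, j ≠ i → j ≠ l → y j = x j := fun j h₁ h₂ => by simp [y, h₁, h₂]
  have hlow : ∀ j, j < i → x j ≤ u := fun j hj => by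
    by_contra! h
    exact (hi j ((hS j).2 ⟨h, (hx hj.le).trans_lt hiv⟩)).not_gt hj
  have hhigh : ∀ j, l < j → v ≤ x j := fun j hj => by
    by_contra! h
    exact (hl j ((hS j).2 ⟨hul.trans_le (hx hj.le), h⟩)).not_gt hj
  have hxil := hx hil.le
  refine ⟨y, ?_, ?_, ?_, ?_⟩
  · intro c d hcd
    rcases hcd.eq_or_lt with rfl | hcd
    · exact le_rfl
    have hxcd := hx hcd.le
    by_cases hci : c = i
    · subst hci
      rw [hyi]
      by_cases hdl : d = l
      · subst hdl; rw [hyl]; linarith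
      · rw [hyj d hcd.ne' hdl]; linarith
    by_cases hcl : c = l
    · subst hcl
      rw [hyl, hyj d (hil.trans hcd).ne' hcd.ne']
      have := hhigh d hcd
      linarith
    rw [hyj c hci hcl]
    by_cases hdi : d = i
    · subst hdi
      rw [hyi]
      have := hlow c hcd
      linarith
    by_cases hdl : d = l
    · subst hdl; rw [hyl]; linarith
    rwa [hyj d hdi hdl]
  · intro j
    by_cases hji : j = i
    · subst hji; right; rw [hyi]; constructor <;> linarith
    by_cases hjl : j = l
    · subst hjl; right; rw [hyl]; constructor <;> linarith
    exact Or.inl (hyj j hji hjl)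
  · have hxi : x i ∉ E := fun h => by rcases huv _ h with h | h <;> linarith
    have hxl : x l ∉ E := fun h => by rcases huv _ h with h | h <;> linarith
    refine Set.ncard_lt_ncard ⟨?_, ?_⟩ (Set.toFinite _)
    · intro j hj
      by_cases hji : j = i
      · rwa [hji]
      by_cases hjl : j = l
      · rwa [hjl]
      simpa [hyj j hji hjl] using hj
    · intro hsub
      rcases hend with h | h
      · exact hsub hxi (by rw [hyi, h]; exact hu)
      · exact hsub hxl (by rw [hyl, h]; exact hv)
  · intro t ht
    have hl' : l ∈ Finset.univ.erase i := by simp [hil.ne']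
    have hprod : ∀ f : Fin n → ℝ, ∏ j, f j =
        f i * f l * ∏ j ∈ (Finset.univ.erase i).erase l, f j := fun f => by
      rw [← Finset.mul_prod_erase _ f (Finset.mem_univ i), ← Finset.mul_prod_erase _ f hl',
        mul_assoc]
    rw [hprod, hprod fun j => |t - x j| ^ r j]
    have hrest : ∏ j ∈ (Finset.univ.erase i).erase l, |t - y j| ^ r j =
        ∏ j ∈ (Finset.univ.erase i).erase l, |t - x j| ^ r j := by
      refine Finset.prod_congr rfl fun j hj => ?_
      simp only [Finset.mem_erase] at hj
      rw [hyj j hj.2.1 hj.1]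
    rw [hrest, hyi, hyl]
    refine mul_le_mul_of_nonneg_right (rpow_mul_rpow_le_of_spread hri hrl hε hxil ?_)
      (Finset.prod_nonneg fun j _ => by positivity)
    rcases huv t ht with h | h
    · left; linarith
    · right; linarith

/-- Every node system in the hull of a compact set `E` can be replaced, without increasing the
product anywhere on `E`, by one in which any two nodes are separated by a point of `E`. -/
theorem exists_separated_nodes {E : Set ℝ} (hE : IsCompact E) {A B : ℝ} (hA : A ∈ E) (hB : B ∈ E)
    {n : ℕ} {r : Fin n → ℝ} (hr : ∀ j, 0 < r j) (x : Fin n → ℝ) (hx : Monotone x)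
    (hxAB : ∀ j, x j ∈ Icc A B) (hEAB : E ⊆ Icc A B) :
    ∃ y : Fin n → ℝ, Monotone y ∧ (∀ j, y j ∈ Icc A B) ∧
      (∀ p q, p < q → ∃ e ∈ E, y p ≤ e ∧ e ≤ y q) ∧
      ∀ t ∈ E, ∏ j, |t - y j| ^ r j ≤ ∏ j, |t - x j| ^ r j := by
  induction hm : {j | x j ∉ E}.ncard using Nat.strong_induction_on generalizing x with
  | _ m ih =>
    by_cases hsep : ∀ p q, p < q → ∃ e ∈ E, x p ≤ e ∧ e ≤ x q
    · exact ⟨x, hx, hxAB, hsep, fun t _ => le_rfl⟩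
    push Not at hsep
    obtain ⟨p, q, hpq, hno⟩ := hsep
    obtain ⟨u, ⟨huE, hup⟩, hu⟩ := (hE.inter_right (isClosed_Iic (a := x p))).exists_isGreatest
      ⟨A, hA, (hxAB p).1⟩
    obtain ⟨v, ⟨hvE, hqv⟩, hv⟩ := (hE.inter_right (isClosed_Ici (a := x q))).exists_isLeast
      ⟨B, hB, (hxAB q).2⟩
    have hup' : u < x p := lt_of_le_of_ne hup fun h => by
      have := hno u huE h.ge
      have := hx hpq.le
      linarith
    have hqv' : x q < v := by
      refine lt_of_le_of_ne hqv fun h => ?_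
      have := hno v hvE (by rw [← h]; exact hx hpq.le)
      linarith
    have huv : ∀ e ∈ E, e ≤ u ∨ v ≤ e := fun e he => by
      rcases le_or_gt e (x p) with h | h
      · exact Or.inl (hu ⟨he, h⟩)
      · exact Or.inr (hv ⟨he, (hno e he h.le).le⟩)
    obtain ⟨y, hy, hyx, hcard, hle⟩ :=
      exists_ncard_notMem_lt hr hx huE hvE huv hpq hup' hqv'
    have hyAB : ∀ j, y j ∈ Icc A B := fun j => by
      rcases hyx j with h | h
      · rw [h]; exact hxAB j
      · exact ⟨(hEAB huE).1.trans h.1, h.2.trans (hEAB hvE).2⟩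
    obtain ⟨z, hz, hzAB, hzsep, hzle⟩ := ih _ (hm ▸ hcard) y hy hyAB rfl
    exact ⟨z, hz, hzAB, hzsep, fun t ht => (hzle t ht).trans (hle t ht)⟩

/-- Nearest-point rounding into `E`: only the nodes outside `E` contribute a factor `2`. -/
theorem exists_rounded_nodes {E : Set ℝ} (hE : IsCompact E) (hne : E.Nonempty)
    {n : ℕ} {r : Fin n → ℝ} (hr : ∀ j, 0 < r j) {x : Fin n → ℝ}
    (hsep : ∀ p q, p < q → ∃ e ∈ E, x p ≤ e ∧ e ≤ x q) (D : Finset (Fin n))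
    (hD : ∀ j, j ∉ D → x j ∈ E) :
    ∃ y : Fin n → ℝ, Monotone y ∧ (∀ j, y j ∈ E) ∧
      ∀ t ∈ E, ∏ j, |t - y j| ^ r j ≤ 2 ^ (∑ j ∈ D, r j) * ∏ j, |t - x j| ^ r j := by
  classical
  have hnear : ∀ j, ∃ y ∈ E, ∀ e ∈ E, |x j - y| ≤ |x j - e| := fun j => by
    obtain ⟨y, hy, hmin⟩ := hE.exists_isMinOn hne
      (f := fun e => |x j - e|) (by fun_prop)
    exact ⟨y, hy, fun e he => hmin he⟩
  choose y hyE hy using hnear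
  have hfix : ∀ j, x j ∈ E → y j = x j := fun j hj => by
    have := hy j (x j) hj
    rw [sub_self, abs_zero] at this
    have := abs_nonpos_iff.1 this
    linarith
  refine ⟨y, ?_, hyE, ?_⟩
  · intro p q hpq
    rcases hpq.eq_or_lt with rfl | hpq
    · exact le_rfl
    obtain ⟨e, he, hpe, heq⟩ := hsep p q hpq
    have h₁ : y p ≤ e := by
      by_contra! h
      have := hy p e he
      rw [abs_of_nonpos (by linarith), abs_of_nonpos (by linarith)] at this
      linarith
    have h₂ : e ≤ y q := by
      by_contra! h
      have := hy q e he
      rw [abs_of_nonneg (by linarith), abs_of_nonneg (by linarith)] at this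
      linarith
    exact h₁.trans h₂
  · intro t ht
    have hpow : (2 : ℝ) ^ (∑ j ∈ D, r j) = ∏ j, if j ∈ D then (2 : ℝ) ^ r j else 1 := by
      rw [Real.rpow_sum_of_pos two_pos, Finset.prod_ite_mem, Finset.univ_inter]
    rw [hpow, ← Finset.prod_mul_distrib]
    refine Finset.prod_le_prod (fun j _ => by positivity) fun j _ => ?_
    split_ifs with hj
    · rw [← Real.mul_rpow two_pos.le (abs_nonneg _)]
      refine Real.rpow_le_rpow (abs_nonneg _) ?_ (hr j).le
      have h₁ := hy j t ht
      have h₂ := abs_sub_le t (x j) (y j)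
      rw [abs_sub_comm (x j) t] at h₁
      linarith
    · rw [hfix j (hD j hj), one_mul]

/-- In a separated node system, fewer than `k` nodes of the hull lie outside a union of `k`
intervals. -/
theorem card_le_of_separated {k n : ℕ} {a b : Fin k → ℝ} {E : Set ℝ}
    (hEab : E = ⋃ ℓ, Icc (a ℓ) (b ℓ)) {A B : ℝ} (hA : A ∈ E) (hB : B ∈ E) {x : Fin n → ℝ}
    (hxAB : ∀ j, x j ∈ Icc A B) (hsep : ∀ p q, p < q → ∃ e ∈ E, x p ≤ e ∧ e ≤ x q)
    (D : Finset (Fin n)) (hD : ∀ j ∈ D, x j ∉ E) : D.card ≤ k - 1 := by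
  classical
  have hmem : ∀ e, e ∈ E ↔ ∃ ℓ, a ℓ ≤ e ∧ e ≤ b ℓ := fun e => by simp [hEab]
  let c : Fin n → ℕ := fun j => (Finset.univ.filter fun ℓ => a ℓ ≤ x j).card
  have hc : ∀ p ∈ D, ∀ q ∈ D, p < q → c p < c q := fun p hp q hq hpq => by
    obtain ⟨e, he, hpe, heq⟩ := hsep p q hpq
    obtain ⟨ℓ, haℓ, hbℓ⟩ := (hmem e).1 he
    have hpℓ : x p < a ℓ := by
      by_contra! h
      exact hD p hp ((hmem _).2 ⟨ℓ, h, hpe.trans hbℓ⟩)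
    refine Finset.card_lt_card ⟨fun m hm => ?_, fun hsub => ?_⟩
    · simp only [Finset.mem_filter, Finset.mem_univ, true_and] at hm ⊢
      exact hm.trans (hpe.trans heq)
    · have := hsub (show ℓ ∈ _ by simpa using haℓ.trans heq)
      simp only [Finset.mem_filter, Finset.mem_univ, true_and] at this
      linarith
  have hmaps : ∀ j ∈ D, c j ∈ Finset.Ico 1 k := fun j hj => by
    rw [Finset.mem_Ico]
    constructor
    · obtain ⟨ℓ, haℓ, -⟩ := (hmem A).1 hA
      exact Finset.card_pos.2 ⟨ℓ, by simpa using haℓ.trans (hxAB j).1⟩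
    · obtain ⟨ℓ, -, hbℓ⟩ := (hmem B).1 hB
      have hlt : x j < a ℓ := by
        by_contra! h
        exact hD j hj ((hmem _).2 ⟨ℓ, h, (hxAB j).2.trans hbℓ⟩)
      calc c j < (Finset.univ : Finset (Fin k)).card :=
            Finset.card_lt_univ_of_notMem (x := ℓ) (by simpa using hlt)
        _ = k := by simp
  have hinj : Set.InjOn c D := fun p hp q hq h => by
    rcases lt_trichotomy p q with hlt | heq | hlt
    · exact absurd h (hc p hp q hq hlt).ne
    · exact heq
    · exact absurd h (hc q hq p hp hlt).ne'
  simpa using Finset.card_le_card_of_injOn c hmaps hinj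

theorem prod_abs_sub_clamp_le {A B t : ℝ} (ht : t ∈ Icc A B) {n : ℕ} {r : Fin n → ℝ}
    (hr : ∀ j, 0 < r j) (x : Fin n → ℝ) :
    ∏ j, |t - max A (min (x j) B)| ^ r j ≤ ∏ j, |t - x j| ^ r j := by
  refine Finset.prod_le_prod (fun j _ => by positivity) fun j _ => ?_
  refine Real.rpow_le_rpow (abs_nonneg _) ?_ (hr j).le
  have h : t = max A (min t B) := by rw [min_eq_left ht.2, max_eq_right ht.1]
  calc |t - max A (min (x j) B)| = |max A (min t B) - max A (min (x j) B)| := by rw [← h]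
    _ ≤ |min t B - min (x j) B| := by
        simpa [max_comm A] using abs_max_sub_max_le_abs (min t B) (min (x j) B) A
    _ ≤ |t - x j| := by
        simpa using abs_min_sub_min_le_max t B (x j) B

theorem exists_nodes_mem_prod_le {k n : ℕ} {a b : Fin k → ℝ}
    (hne : (⋃ ℓ, Icc (a ℓ) (b ℓ)).Nonempty) {r : Fin n → ℝ} (hr : ∀ j, 0 < r j)
    {x : Fin n → ℝ} (hx : Monotone x) :
    ∃ y : Fin n → ℝ, ∃ D : Finset (Fin n), D.card ≤ k - 1 ∧ Monotone y ∧
      (∀ j, y j ∈ ⋃ ℓ, Icc (a ℓ) (b ℓ)) ∧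
      ∀ t ∈ ⋃ ℓ, Icc (a ℓ) (b ℓ),
        ∏ j, |t - y j| ^ r j ≤ 2 ^ (∑ j ∈ D, r j) * ∏ j, |t - x j| ^ r j := by
  classical
  set E := ⋃ ℓ, Icc (a ℓ) (b ℓ) with hEdef
  have hE : IsCompact E := isCompact_iUnion fun _ => isCompact_Icc
  obtain ⟨A, hA, hAle⟩ := hE.exists_isLeast hne
  obtain ⟨B, hB, hBge⟩ := hE.exists_isGreatest hne
  have hEAB : E ⊆ Icc A B := fun t ht => ⟨hAle ht, hBge ht⟩
  obtain ⟨y, -, hyAB, hysep, hyle⟩ := exists_separated_nodes hE hA hB hr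
    (fun j => max A (min (x j) B))
    (fun p q h => max_le_max le_rfl (min_le_min (hx h) le_rfl))
    (fun j => ⟨le_max_left _ _, max_le (hAle hB) (min_le_right _ _)⟩) hEAB
  let D : Finset (Fin n) := Finset.univ.filter fun j => y j ∉ E
  obtain ⟨z, hz, hzE, hzle⟩ := exists_rounded_nodes hE hne hr hysep D
    (fun j hj => by simpa [D] using hj)
  refine ⟨z, D, card_le_of_separated hEdef hA hB hyAB hysep D (fun j hj => by simpa [D] using hj),
    hz, hzE, fun t ht => (hzle t ht).trans ?_⟩
  exact mul_le_mul_of_nonneg_left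
    ((hyle t ht).trans (prod_abs_sub_clamp_le (hEAB ht) hr x)) (by positivity)

theorem enorm_nonneg_of_nonneg {w : ℝ → ℝ} (hw0 : ∀ t, 0 ≤ w t) (E : Set ℝ) {n : ℕ}
    (r x : Fin n → ℝ) : 0 ≤ _root_.enorm w E r x := by
  refine Real.sSup_nonneg ?_
  rintro _ ⟨t, -, rfl⟩
  exact mul_nonneg (hw0 t) (Finset.prod_nonneg fun j _ => by positivity)

theorem bddAbove_weighted_prod {w : ℝ → ℝ} (hw0 : ∀ t, 0 ≤ w t) (husc : UpperSemicontinuous w)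
    {E : Set ℝ} (hE : IsCompact E) {n : ℕ} {r : Fin n → ℝ} (hr : ∀ j, 0 < r j) (x : Fin n → ℝ) :
    BddAbove ((fun t => w t * ∏ j, |t - x j| ^ r j) '' E) := by
  obtain ⟨W, hW⟩ := (husc.upperSemicontinuousOn E).bddAbove_of_isCompact hE
  have hcont : Continuous fun t : ℝ => ∏ j, |t - x j| ^ r j :=
    continuous_finsetProd _ fun j _ =>
      Continuous.rpow_const (by fun_prop) fun _ => Or.inr (hr j).le
  obtain ⟨P, hP⟩ := hE.bddAbove_image hcont.continuousOn
  refine ⟨W * P, ?_⟩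
  rintro _ ⟨t, ht, rfl⟩
  exact mul_le_mul (hW ⟨t, ht, rfl⟩) (hP ⟨t, ht, rfl⟩)
    (Finset.prod_nonneg fun j _ => by positivity) ((hw0 t).trans (hW ⟨t, ht, rfl⟩))

theorem enorm_le_mul_enorm {w : ℝ → ℝ} (hw0 : ∀ t, 0 ≤ w t) (husc : UpperSemicontinuous w)
    {E : Set ℝ} (hE : IsCompact E) (hne : E.Nonempty) {n : ℕ} {r : Fin n → ℝ}
    (hr : ∀ j, 0 < r j) {x y : Fin n → ℝ} {c : ℝ} (hc : 0 ≤ c)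
    (h : ∀ t ∈ E, ∏ j, |t - y j| ^ r j ≤ c * ∏ j, |t - x j| ^ r j) :
    _root_.enorm w E r y ≤ c * _root_.enorm w E r x := by
  refine csSup_le (hne.image _) ?_
  rintro _ ⟨t, ht, rfl⟩
  calc w t * ∏ j, |t - y j| ^ r j ≤ w t * (c * ∏ j, |t - x j| ^ r j) :=
        mul_le_mul_of_nonneg_left (h t ht) (hw0 t)
    _ = c * (w t * ∏ j, |t - x j| ^ r j) := by ring
    _ ≤ c * _root_.enorm w E r x := mul_le_mul_of_nonneg_left
        (le_csSup (bddAbove_weighted_prod hw0 husc hE hr x) ⟨t, ht, rfl⟩) hc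

theorem CconstE_le_RconstE {w : ℝ → ℝ} (hw0 : ∀ t, 0 ≤ w t) {E : Set ℝ} (hne : E.Nonempty)
    {n : ℕ} (r : Fin n → ℝ) : CconstE w E r ≤ RconstE w E r := by
  obtain ⟨e, he⟩ := hne
  refine csInf_le_csInf ⟨0, ?_⟩ ⟨_, fun _ => e, monotone_const, fun _ => he, rfl⟩ ?_
  · rintro _ ⟨x, -, rfl⟩
    exact enorm_nonneg_of_nonneg hw0 E r x
  · rintro _ ⟨x, hx, -, rfl⟩
    exact ⟨x, hx, rfl⟩

theorem RconstE_le_mul_CconstE {w : ℝ → ℝ} (hw0 : ∀ t, 0 ≤ w t) (husc : UpperSemicontinuous w)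
    {k n : ℕ} {a b : Fin k → ℝ} (hne : (⋃ ℓ, Icc (a ℓ) (b ℓ)).Nonempty) {r : Fin n → ℝ}
    (hr : ∀ j, 0 < r j) {M : ℝ} (hM : ∀ D : Finset (Fin n), D.card ≤ k - 1 → ∑ j ∈ D, r j ≤ M) :
    RconstE w (⋃ ℓ, Icc (a ℓ) (b ℓ)) r ≤ 2 ^ M * CconstE w (⋃ ℓ, Icc (a ℓ) (b ℓ)) r := by
  have h2M : (0 : ℝ) < 2 ^ M := by positivity
  rw [← div_le_iff₀' h2M]
  refine le_csInf ⟨_, fun _ => 0, monotone_const, rfl⟩ ?_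
  rintro _ ⟨x, hx, rfl⟩
  rw [div_le_iff₀' h2M]
  obtain ⟨y, D, hD, hy, hyE, hle⟩ := exists_nodes_mem_prod_le hne hr hx
  refine le_trans (csInf_le ⟨0, ?_⟩ ⟨y, hy, hyE, rfl⟩) (enorm_le_mul_enorm hw0 husc
    (isCompact_iUnion fun _ => isCompact_Icc) hne hr h2M.le fun t ht => (hle t ht).trans ?_)
  · rintro _ ⟨z, -, -, rfl⟩
    exact enorm_nonneg_of_nonneg hw0 _ r z
  · exact mul_le_mul_of_nonneg_right (Real.rpow_le_rpow_of_exponent_le one_le_two (hM D hD))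
      (Finset.prod_nonneg fun j _ => by positivity)

theorem statement19 (k n : ℕ) (hk : 0 < k) (hn : 0 < n)
    (a b : Fin k → ℝ) (hab : ∀ ℓ, a ℓ < b ℓ)
    (hsep : ∀ ℓ : Fin k, ∀ h : (ℓ : ℕ) + 1 < k, b ℓ < a ⟨(ℓ : ℕ) + 1, h⟩)
    (r : Fin n → ℝ) (hr : ∀ j, 0 < r j)
    (w : ℝ → ℝ) (hw0 : ∀ t, 0 ≤ w t) (husc : UpperSemicontinuous w)
    (hcard : ∃ T : Finset ℝ, (T : Set ℝ) ⊆ (⋃ ℓ, Icc (a ℓ) (b ℓ)) ∧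
      (∀ t ∈ T, w t ≠ 0) ∧
      (n : ℝ) < ∑ t ∈ T,
        (if t = a ⟨0, hk⟩ ∨ t = b ⟨k - 1, by omega⟩ then (1/2 : ℝ) else 1)) :
    CconstE w (⋃ ℓ, Icc (a ℓ) (b ℓ)) r ≤ RconstE w (⋃ ℓ, Icc (a ℓ) (b ℓ)) r ∧
    RconstE w (⋃ ℓ, Icc (a ℓ) (b ℓ)) r ≤
      (2 : ℝ) ^ sSup {s : ℝ | ∃ A : Finset (Fin n), A.card ≤ k - 1 ∧ s = ∑ i ∈ A, r i} *
        CconstE w (⋃ ℓ, Icc (a ℓ) (b ℓ)) r ∧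
    ((∀ j, r j = 1) →
      RconstE w (⋃ ℓ, Icc (a ℓ) (b ℓ)) r ≤
        2 ^ (k - 1) * CconstE w (⋃ ℓ, Icc (a ℓ) (b ℓ)) r) := by
  have hne : (⋃ ℓ, Icc (a ℓ) (b ℓ)).Nonempty :=
    ⟨a ⟨0, hk⟩, mem_iUnion.2 ⟨_, left_mem_Icc.2 (hab _).le⟩⟩
  refine ⟨CconstE_le_RconstE hw0 hne r, ?_, fun hr1 => ?_⟩
  · refine RconstE_le_mul_CconstE hw0 husc hne hr fun D hD => le_csSup ⟨∑ j, r j, ?_⟩ ⟨D, hD, rfl⟩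
    rintro _ ⟨A, -, rfl⟩
    exact Finset.sum_le_sum_of_subset_of_nonneg (Finset.subset_univ A) fun j _ _ => (hr j).le
  · have h := RconstE_le_mul_CconstE hw0 husc hne hr (M := ((k - 1 : ℕ) : ℝ)) fun D hD => by
      simpa [hr1] using hD
    rwa [Real.rpow_natCast] at h
end
end
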